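/- arXiv:2111.09584 — 2 statements merged into one kernel-verified Lean document; each statement's English description precedes it below -/
import Mathlib

section
/- The identity component (for the subspace topology induced from SL_N(ℝ)) of the group N_{SO_N(ℝ)}(U_{𝓘₀})·U_{𝓘₀} equals K_{𝓘₀}·U_{𝓘₀}, where N_{SO_N(ℝ)}(U_{𝓘₀}) is the normalizer of U_{𝓘₀} in SO_N(ℝ). -/
open Matrix Pointwise

variable {N k₀ : ℕ}

/-- The subspace topology on `SL_N(ℝ)` induced from the space of matrices. -/
instance (n : Type*) [Fintype n] [DecidableEq n] :
    TopologicalSpace (Matrix.SpecialLinearGroup n ℝ) :=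
  TopologicalSpace.induced (Subtype.val) inferInstance

/-- The block upper-triangular unipotent group `U_{𝓘₀}`. -/
def Ugrp (c : Fin N → Fin k₀) : Set (Matrix.SpecialLinearGroup (Fin N) ℝ) :=
  {g | ∀ i j : Fin N, c j ≤ c i → g.1 i j = (1 : Matrix (Fin N) (Fin N) ℝ) i j}

/-- `K = SO_N(ℝ)`, viewed as a subset of `SL_N(ℝ)`. -/
def SOset (N : ℕ) : Set (Matrix.SpecialLinearGroup (Fin N) ℝ) :=
  {g | g.1 * g.1ᵀ = 1}

/-- The normalizer `N_K(U_{𝓘₀}) = {k ∈ K : k U_{𝓘₀} k⁻¹ = U_{𝓘₀}}` of `U_{𝓘₀}` in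
`K = SO_N(ℝ)`. -/
def NKset (c : Fin N → Fin k₀) : Set (Matrix.SpecialLinearGroup (Fin N) ℝ) :=
  {g | g ∈ SOset N ∧ (fun u => g * u * g⁻¹) '' Ugrp c = Ugrp c}

/-- The `k`-th diagonal block of a matrix `A`, as a matrix indexed by `{i // c i = k}`. -/
def blockOf (c : Fin N → Fin k₀) (A : Matrix (Fin N) (Fin N) ℝ) (k : Fin k₀) :
    Matrix {i : Fin N // c i = k} {i : Fin N // c i = k} ℝ :=
  Matrix.of fun i j => A i.1 j.1

/-- The block-diagonal group `K_{𝓘₀} = SO(n_1) × ⋯ × SO(n_{k₀})`. -/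
def Kgrp (c : Fin N → Fin k₀) : Set (Matrix.SpecialLinearGroup (Fin N) ℝ) :=
  {g | (∀ i j : Fin N, c i ≠ c j → g.1 i j = 0) ∧
    ∀ k : Fin k₀, blockOf c g.1 k * (blockOf c g.1 k)ᵀ = 1 ∧ (blockOf c g.1 k).det = 1}

lemma IsPreconnected.set_mul {M : Type*} [TopologicalSpace M] [Mul M] [ContinuousMul M]
    {s t : Set M} (hs : IsPreconnected s) (ht : IsPreconnected t) : IsPreconnected (s * t) := by
  rw [← Set.image_mul_prod]
  exact (hs.prod ht).image _ continuous_mul.continuousOn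

section SpecialIsometries

open Module

variable {E : Type*} [NormedAddCommGroup E] [InnerProductSpace ℝ E]

/-- The linear isometries of determinant one, as a set of continuous linear endomorphisms. -/
def specialIsometries (E : Type*) [NormedAddCommGroup E] [InnerProductSpace ℝ E] :
    Set (E →L[ℝ] E) :=
  {f | LinearMap.det (f : E →ₗ[ℝ] E) = 1 ∧ ∃ φ : E ≃ₗᵢ[ℝ] E, (φ : E →L[ℝ] E) = f}

lemma one_mem_specialIsometries : (1 : E →L[ℝ] E) ∈ specialIsometries E :=
  ⟨LinearMap.det_id, 1, rfl⟩

lemma mul_mem_specialIsometries {f g : E →L[ℝ] E} (hf : f ∈ specialIsometries E)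
    (hg : g ∈ specialIsometries E) : f * g ∈ specialIsometries E := by
  obtain ⟨hf, φ, rfl⟩ := hf
  obtain ⟨hg, ψ, rfl⟩ := hg
  refine ⟨?_, φ * ψ, rfl⟩
  have := LinearMap.det_comp ((φ : E →L[ℝ] E) : E →ₗ[ℝ] E) ((ψ : E →L[ℝ] E) : E →ₗ[ℝ] E)
  rw [hf, hg, one_mul] at this
  exact this

/-- The reflection in the hyperplane orthogonal to `v`, as a continuous linear endomorphism. -/
noncomputable def hyperplaneReflection (v : E) : E →L[ℝ] E :=
  ((ℝ ∙ v)ᗮ.reflection : E →L[ℝ] E)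

lemma hyperplaneReflection_mul_self (v : E) :
    hyperplaneReflection v * hyperplaneReflection v = 1 := by
  ext x
  simp [hyperplaneReflection]

lemma hyperplaneReflection_eq {v : E} (hv : ‖v‖ = 1) :
    hyperplaneReflection v = 1 - (2 : ℝ) • (innerSL ℝ v).smulRight v := by
  ext x
  simp [hyperplaneReflection, Submodule.reflection_apply, Submodule.starProjection_orthogonal,
    Submodule.starProjection_unit_singleton ℝ hv]
  module

lemma continuousOn_hyperplaneReflection :
    ContinuousOn (hyperplaneReflection (E := E)) (Metric.sphere 0 1) := by
  refine ContinuousOn.congr (f := fun v => 1 - (2 : ℝ) • (innerSL ℝ v).smulRight v) ?_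
    fun v hv => hyperplaneReflection_eq (by simpa using hv)
  refine Continuous.continuousOn ?_
  have h : Continuous fun v : E => ContinuousLinearMap.smulRightL ℝ E E (innerSL ℝ v) v := by
    fun_prop
  exact continuous_const.sub (h.fun_const_smul (2 : ℝ))

lemma det_hyperplaneReflection [FiniteDimensional ℝ E] {v : E} (hv : v ≠ 0) :
    LinearMap.det (hyperplaneReflection v : E →ₗ[ℝ] E) = -1 := by
  have : LinearMap.det ((ℝ ∙ v)ᗮ.reflection.toLinearMap) = -1 := by
    rw [Submodule.det_reflection, Submodule.orthogonal_orthogonal, finrank_span_singleton hv,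
      pow_one]
  exact this

lemma hyperplaneReflection_zero : hyperplaneReflection (0 : E) = 1 := by
  ext x
  change (ℝ ∙ (0 : E))ᗮ.reflection x = x
  exact Submodule.reflection_mem_subspace_eq_self (by simp)

lemma hyperplaneReflection_smul {r : ℝ} (hr : r ≠ 0) (v : E) :
    hyperplaneReflection (r • v) = hyperplaneReflection v := by
  have h : (ℝ ∙ (r • v)) = ℝ ∙ v := Submodule.span_singleton_smul_eq (IsUnit.mk0 r hr) v
  ext x
  simp only [hyperplaneReflection]
  simp [h]

lemma exists_unit_list_hyperplaneReflection (l : List E) :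
    ∃ l' : List E, l'.length ≤ l.length ∧ (∀ v ∈ l', ‖v‖ = 1) ∧
      (l'.map hyperplaneReflection).prod = (l.map hyperplaneReflection).prod := by
  induction l with
  | nil => exact ⟨[], by simp⟩
  | cons v l ih =>
    obtain ⟨l', hlen, hunit, hprod⟩ := ih
    by_cases hv : v = 0
    · exact ⟨l', by grind, hunit, by simp [hv, hprod, hyperplaneReflection_zero]⟩
    · have hv' : ‖v‖ ≠ 0 := norm_ne_zero_iff.mpr hv
      refine ⟨(‖v‖⁻¹ • v) :: l', by simpa using hlen, ?_, ?_⟩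
      · simpa [norm_smul, hv'] using hunit
      · simp [hyperplaneReflection_smul (inv_ne_zero hv'), hprod]

lemma det_prod_hyperplaneReflection [FiniteDimensional ℝ E] {l : List E} (hl : ∀ v ∈ l, ‖v‖ = 1) :
    LinearMap.det ((l.map hyperplaneReflection).prod : E →ₗ[ℝ] E) = (-1) ^ l.length := by
  induction l with
  | nil => exact LinearMap.det_id
  | cons v l ih =>
    have hv : v ≠ 0 := by
      rintro rfl
      simpa using hl 0
    rw [List.map_cons, List.prod_cons, List.length_cons, pow_succ',
      ← ih fun w hw => hl w (List.mem_cons_of_mem _ hw), ← det_hyperplaneReflection hv]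
    exact LinearMap.det_comp _ _

lemma exists_isPreconnected_prod_hyperplaneReflection [FiniteDimensional ℝ E]
    (hE : 1 < Module.rank ℝ E) :
    ∀ l : List E, (∀ v ∈ l, ‖v‖ = 1) → Even l.length →
      ∃ t ⊆ specialIsometries E, 1 ∈ t ∧ (l.map hyperplaneReflection).prod ∈ t ∧ IsPreconnected t
  | [], _, _ => ⟨{1}, by simpa using one_mem_specialIsometries, rfl, rfl, isPreconnected_singleton⟩
  | [a], _, h => by simp at h
  | a :: b :: l, hl, h => by
    obtain ⟨t, ht, h1, hprod, hconn⟩ := exists_isPreconnected_prod_hyperplaneReflection hE l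
      (fun v hv => hl v (by simp [hv])) (by simpa [Nat.even_add_one] using h)
    have ha : ‖a‖ = 1 := hl a (by simp)
    have hb : ‖b‖ = 1 := hl b (by simp)
    have hs : IsPreconnected
        ((fun u : E => hyperplaneReflection u * hyperplaneReflection b) '' Metric.sphere 0 1) :=
      (isPreconnected_sphere hE 0 1).image _
        (continuousOn_hyperplaneReflection.mul continuousOn_const)
    refine ⟨((fun u : E => hyperplaneReflection u * hyperplaneReflection b) ''
        Metric.sphere 0 1) * t, Set.mul_subset_iff.mpr ?_, Set.mem_mul.mpr ⟨1, ⟨b, ?_, ?_⟩, 1, h1, one_mul 1⟩,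
      Set.mem_mul.mpr ⟨_, ⟨a, ?_, rfl⟩, _, hprod, ?_⟩, hs.set_mul hconn⟩
    · rintro _ ⟨u, hu, rfl⟩ g hg
      refine mul_mem_specialIsometries ⟨?_, (ℝ ∙ u)ᗮ.reflection * (ℝ ∙ b)ᗮ.reflection, rfl⟩ (ht hg)
      have := det_prod_hyperplaneReflection (l := [u, b]) (by simpa [hb] using hu)
      simpa using this
    · simpa using hb
    · exact hyperplaneReflection_mul_self b
    · simpa using ha
    · simp [mul_assoc]

lemma isPreconnected_specialIsometries [FiniteDimensional ℝ E] :
    IsPreconnected (specialIsometries E) := by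
  refine isPreconnected_of_forall 1 ?_
  rintro _ ⟨hdet, φ, rfl⟩
  obtain ⟨l₀, hlen₀, hφ⟩ := φ.reflections_generate_dim
  obtain ⟨l, hlen, hunit, hprod⟩ := exists_unit_list_hyperplaneReflection l₀
  have hφl : (φ : E →L[ℝ] E) = (l.map hyperplaneReflection).prod := by
    rw [hprod, hφ]
    clear * -
    induction l₀ with
    | nil => rfl
    | cons v l ih =>
      rw [List.map_cons, List.prod_cons, List.map_cons, List.prod_cons, ← ih]
      rfl
  have heven : Even l.length := by
    rw [hφl, det_prod_hyperplaneReflection hunit] at hdet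
    by_contra h
    rw [(Nat.not_even_iff_odd.mp h).neg_one_pow] at hdet
    norm_num at hdet
  rw [hφl]
  by_cases hE : 1 < Module.rank ℝ E
  · exact exists_isPreconnected_prod_hyperplaneReflection hE l hunit heven
  · have hrank : finrank ℝ E ≤ 1 := by
      rw [← finrank_eq_rank] at hE
      exact_mod_cast not_lt.mp hE
    have hl : l = [] := by
      rw [← List.length_eq_zero_iff]
      obtain ⟨k, hk⟩ := heven
      omega
    subst hl
    exact ⟨{1}, by simpa using one_mem_specialIsometries, rfl, rfl, isPreconnected_singleton⟩

end SpecialIsometries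

lemma Matrix.det_toEuclideanCLM {n : Type*} [Fintype n] [DecidableEq n] (M : Matrix n n ℝ) :
    LinearMap.det (Matrix.toEuclideanCLM (n := n) (𝕜 := ℝ) M :
      EuclideanSpace ℝ n →ₗ[ℝ] EuclideanSpace ℝ n) = M.det := by
  rw [Matrix.coe_toEuclideanCLM_eq_toEuclideanLin, Matrix.toEuclideanLin, Matrix.toLpLin_eq_toLin,
    LinearMap.det_toLin]

lemma isPreconnected_specialOrthogonal (n : Type*) [Fintype n] [DecidableEq n] :
    IsPreconnected {M : Matrix n n ℝ | M * Mᵀ = 1 ∧ M.det = 1} := by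
  let e := Matrix.toEuclideanCLM (n := n) (𝕜 := ℝ)
  have hcont : Continuous e.symm :=
    LinearMap.continuous_of_finiteDimensional
      (e.symm.toAlgEquiv.toLinearMap : (EuclideanSpace ℝ n →L[ℝ] EuclideanSpace ℝ n) →ₗ[ℝ] _)
  convert isPreconnected_specialIsometries.image e.symm hcont.continuousOn using 1
  ext M
  constructor
  · rintro ⟨hM, hdet⟩
    have hu : M ∈ unitary (Matrix n n ℝ) := Matrix.mem_unitaryGroup_iff.mpr hM
    exact ⟨e M, ⟨(Matrix.det_toEuclideanCLM M).trans hdet,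
      Unitary.linearIsometryEquiv ⟨e M, Unitary.map_mem e hu⟩, rfl⟩, e.symm_apply_apply M⟩
  · rintro ⟨_, ⟨hdet, φ, rfl⟩, rfl⟩
    have hu := Unitary.map_mem e.symm (Unitary.linearIsometryEquiv.symm φ).2
    refine ⟨Matrix.mem_unitaryGroup_iff.mp hu, ?_⟩
    rw [← Matrix.det_toEuclideanCLM]
    exact (congrArg (fun f : EuclideanSpace ℝ n →L[ℝ] EuclideanSpace ℝ n =>
      LinearMap.det (f : EuclideanSpace ℝ n →ₗ[ℝ] EuclideanSpace ℝ n))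
      (e.apply_symm_apply _)).trans hdet

/-- All entries outside the diagonal blocks of the partition into fibres of `c` vanish. -/
def IsBlockDiag (c : Fin N → Fin k₀) (A : Matrix (Fin N) (Fin N) ℝ) : Prop :=
  ∀ i j, c i ≠ c j → A i j = 0

/-- The block-diagonal matrix with prescribed diagonal blocks. -/
def ofBlocks (c : Fin N → Fin k₀)
    (D : ∀ k, Matrix {i : Fin N // c i = k} {i : Fin N // c i = k} ℝ) :
    Matrix (Fin N) (Fin N) ℝ :=
  Matrix.of fun i j => if h : c j = c i then D (c i) ⟨i, rfl⟩ ⟨j, h⟩ else 0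

section BlockDiag

variable {c : Fin N → Fin k₀} {A B : Matrix (Fin N) (Fin N) ℝ}

lemma isBlockDiag_ofBlocks
    (D : ∀ k, Matrix {i : Fin N // c i = k} {i : Fin N // c i = k} ℝ) :
    IsBlockDiag c (ofBlocks c D) := fun _ _ h => by
  simp [ofBlocks, Ne.symm h]

lemma blockOf_ofBlocks (D : ∀ k, Matrix {i : Fin N // c i = k} {i : Fin N // c i = k} ℝ)
    (k : Fin k₀) : blockOf c (ofBlocks c D) k = D k := by
  ext ⟨i, rfl⟩ ⟨j, hj⟩
  simp [ofBlocks, blockOf, hj]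

lemma continuous_ofBlocks : Continuous (ofBlocks c) := by
  refine continuous_matrix fun i j => ?_
  by_cases h : c j = c i
  · simp only [ofBlocks, Matrix.of_apply, h, dite_true]
    fun_prop
  · simp only [ofBlocks, Matrix.of_apply, h, dite_false]
    fun_prop

lemma IsBlockDiag.ext (hA : IsBlockDiag c A) (hB : IsBlockDiag c B)
    (h : ∀ k, blockOf c A k = blockOf c B k) : A = B := by
  ext i j
  by_cases hij : c i = c j
  · exact congrFun (congrFun (h (c j)) ⟨i, hij⟩) ⟨j, rfl⟩
  · rw [hA i j hij, hB i j hij]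

lemma isBlockDiag_one : IsBlockDiag c 1 := fun _ _ h =>
  Matrix.one_apply_ne fun hij => h (congrArg c hij)

lemma IsBlockDiag.transpose (hA : IsBlockDiag c A) : IsBlockDiag c Aᵀ := fun i j h =>
  hA j i (Ne.symm h)

lemma IsBlockDiag.mul (hA : IsBlockDiag c A) (hB : IsBlockDiag c B) : IsBlockDiag c (A * B) := by
  intro i j h
  rw [Matrix.mul_apply]
  refine Finset.sum_eq_zero fun a _ => ?_
  by_cases hia : c i = c a
  · rw [hB a j (hia ▸ h), mul_zero]
  · rw [hA i a hia, zero_mul]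

lemma blockOf_one (k : Fin k₀) : blockOf c 1 k = 1 := by
  ext i j
  simp [blockOf, Matrix.one_apply, Subtype.ext_iff]

lemma IsBlockDiag.blockOf_mul (hA : IsBlockDiag c A) (k : Fin k₀) :
    blockOf c (A * B) k = blockOf c A k * blockOf c B k := by
  ext ⟨i, hi⟩ ⟨j, hj⟩
  simp only [blockOf, Matrix.of_apply, Matrix.mul_apply]
  rw [← Finset.sum_subtype (Finset.univ.filter (c · = k)) (by simp) fun a => A i a * B a j,
    Finset.sum_filter_of_ne]
  intro a _ ha
  by_contra hak
  exact ha (by rw [hA i a (by rw [hi]; exact Ne.symm hak), zero_mul])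

lemma IsBlockDiag.mul_transpose_eq_one_iff (hA : IsBlockDiag c A) :
    A * Aᵀ = 1 ↔ ∀ k, blockOf c A k * (blockOf c A k)ᵀ = 1 := by
  have h (k : Fin k₀) : blockOf c (A * Aᵀ) k = blockOf c A k * (blockOf c A k)ᵀ :=
    hA.blockOf_mul k
  refine ⟨fun hA1 k => by rw [← h, hA1, blockOf_one], fun hA1 => ?_⟩
  exact (hA.mul hA.transpose).ext isBlockDiag_one fun k => by rw [h, hA1, blockOf_one]

lemma IsBlockDiag.det (hA : IsBlockDiag c A) : A.det = ∏ k, (blockOf c A k).det :=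
  Matrix.BlockTriangular.det_fintype (b := c) fun i j h => hA i j h.ne'

end BlockDiag

section Unipotent

variable {c : Fin N → Fin k₀}

lemma blockOf_of_mem_Ugrp {u : Matrix.SpecialLinearGroup (Fin N) ℝ} (hu : u ∈ Ugrp c)
    (k : Fin k₀) : blockOf c u.1 k = 1 := by
  rw [← blockOf_one k]
  ext ⟨i, hi⟩ ⟨j, hj⟩
  exact hu i j (hj.trans hi.symm).le

lemma one_mem_Ugrp : (1 : Matrix.SpecialLinearGroup (Fin N) ℝ) ∈ Ugrp c := fun _ _ _ => rfl

lemma image_val_Ugrp : Subtype.val '' Ugrp c =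
    {M : Matrix (Fin N) (Fin N) ℝ | ∀ i j, c j ≤ c i → M i j = (1 : Matrix _ _ ℝ) i j} := by
  ext M
  refine ⟨fun ⟨u, hu, huM⟩ => huM ▸ hu, fun hM => ⟨⟨M, ?_⟩, hM, rfl⟩⟩
  have hT : M.BlockTriangular c := fun i j h => by
    rw [hM i j h.le, Matrix.one_apply_ne (fun hij => h.ne' (congrArg c hij))]
  rw [hT.det_fintype]
  refine Finset.prod_eq_one fun k _ => ?_
  have : M.toSquareBlock c k = 1 := by
    ext ⟨i, hi⟩ ⟨j, hj⟩
    simp [Matrix.toSquareBlock_def, hM i j (hj.trans hi.symm).le, Matrix.one_apply]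
  rw [this, Matrix.det_one]

lemma isPreconnected_image_val_Ugrp : IsPreconnected (Subtype.val '' Ugrp c) := by
  rw [image_val_Ugrp]
  refine Convex.isPreconnected fun A hA B hB a b _ _ hab i j hij => ?_
  simp only [Matrix.add_apply, Matrix.smul_apply, hA i j hij, hB i j hij, ← add_smul, hab, one_smul]

end Unipotent

section Normalizer

variable {c : Fin N → Fin k₀} {g : Matrix.SpecialLinearGroup (Fin N) ℝ}

lemma val_inv_of_mem_SOset (hg : g ∈ SOset N) : (g⁻¹).1 = g.1ᵀ := by
  have h : (g⁻¹).1 * g.1 = 1 := congrArg Subtype.val (inv_mul_cancel g)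
  calc (g⁻¹).1 = (g⁻¹).1 * (g.1 * g.1ᵀ) := by rw [show g.1 * g.1ᵀ = 1 from hg, mul_one]
    _ = g.1ᵀ := by rw [← mul_assoc, h, one_mul]

lemma inv_mem_SOset (hg : g ∈ SOset N) : g⁻¹ ∈ SOset N := by
  change (g⁻¹).1 * (g⁻¹).1ᵀ = 1
  rw [val_inv_of_mem_SOset hg, Matrix.transpose_transpose]
  exact mul_eq_one_comm.mp hg

lemma conj_mem_Ugrp (hg : g ∈ SOset N) (hd : IsBlockDiag c g.1)
    {u : Matrix.SpecialLinearGroup (Fin N) ℝ} (hu : u ∈ Ugrp c) : g * u * g⁻¹ ∈ Ugrp c := by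
  intro i j hij
  have hval : (g * u * g⁻¹).1 = 1 + g.1 * (u.1 - 1) * g.1ᵀ := by
    change g.1 * u.1 * (g⁻¹).1 = _
    rw [val_inv_of_mem_SOset hg, mul_sub, mul_one, sub_mul, show g.1 * g.1ᵀ = 1 from hg]
    abel
  rw [hval, Matrix.add_apply, add_eq_left, Matrix.mul_apply]
  refine Finset.sum_eq_zero fun b _ => ?_
  by_cases hb : c j = c b
  · rw [Matrix.mul_apply, Finset.sum_eq_zero, zero_mul]
    intro a _
    by_cases ha : c i = c a
    · rw [Matrix.sub_apply, hu a b (by rw [← ha, ← hb]; exact hij), sub_self, mul_zero]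
    · rw [hd i a ha, zero_mul]
  · rw [Matrix.transpose_apply, hd j b hb, mul_zero]

lemma mem_NKset_of_isBlockDiag (hg : g ∈ SOset N) (hd : IsBlockDiag c g.1) : g ∈ NKset c := by
  refine ⟨hg, Set.Subset.antisymm ?_ fun v hv => ⟨g⁻¹ * v * g, ?_, by group⟩⟩
  · rintro _ ⟨u, hu, rfl⟩
    exact conj_mem_Ugrp hg hd hu
  · have hd' : IsBlockDiag c (g⁻¹).1 := val_inv_of_mem_SOset hg ▸ hd.transpose
    simpa using conj_mem_Ugrp (inv_mem_SOset hg) hd' hv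

/-- Conjugating the transvections in `U_{𝓘₀}` shows that the supports of the columns of a
normalizing orthogonal matrix are ordered as the blocks are. -/
lemma class_lt_of_mem_NKset (hg : g ∈ NKset c) {a b i j : Fin N} (hab : c a < c b)
    (hia : g.1 i a ≠ 0) (hjb : g.1 j b ≠ 0) : c i < c j := by
  obtain ⟨hO, hU⟩ := hg
  by_contra! hij
  have hne : a ≠ b := fun h => hab.ne (congrArg c h)
  let u : Matrix.SpecialLinearGroup (Fin N) ℝ :=
    ⟨Matrix.transvection a b 1, Matrix.det_transvection_of_ne a b hne 1⟩
  have hu : u ∈ Ugrp c := by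
    intro x y hxy
    have : ¬ (a = x ∧ b = y) := by
      rintro ⟨rfl, rfl⟩
      exact hab.not_ge hxy
    simp [u, Matrix.transvection, this]
  have hmem : g * u * g⁻¹ ∈ Ugrp c := hU ▸ ⟨u, hu, rfl⟩
  have hval : (g * u * g⁻¹).1 = 1 + g.1 * Matrix.single a b 1 * g.1ᵀ := by
    change g.1 * (1 + Matrix.single a b 1) * (g⁻¹).1 = _
    rw [val_inv_of_mem_SOset hO, mul_add, mul_one, add_mul, show g.1 * g.1ᵀ = 1 from hO]
  have hentry := hmem i j hij
  rw [hval, Matrix.add_apply, add_eq_left, Matrix.single_eq_single_vecMulVec_single,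
    Matrix.mul_vecMulVec, Matrix.vecMulVec_mul, Matrix.vecMulVec_apply] at hentry
  simp [hia, hjb] at hentry

lemma isBlockDiag_of_mem_NKset (hsurj : Function.Surjective c) (hg : g ∈ NKset c) :
    IsBlockDiag c g.1 := by
  have hcol (a : Fin N) : ∃ i, g.1 i a ≠ 0 := by
    by_contra! h
    have hdet := Matrix.det_eq_zero_of_column_eq_zero a h
    rw [g.2] at hdet
    exact one_ne_zero hdet
  intro i j hij
  by_contra hne
  choose s hs using hsurj
  choose r hr using hcol
  let t : Fin k₀ → Fin N := Function.update s (c j) j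
  let q : Fin N → Fin N := Function.update r j i
  have ht (k : Fin k₀) : c (t k) = k := by
    by_cases hk : k = c j
    · subst hk; simp [t]
    · simp [t, hk, hs]
  have hq (a : Fin N) : g.1 (q a) a ≠ 0 := by
    by_cases ha : a = j
    · subst ha; simpa [q] using hne
    · simpa [q, ha] using hr a
  have hmono : StrictMono fun k => c (q (t k)) := fun k l hkl =>
    class_lt_of_mem_NKset hg (by rwa [ht, ht]) (hq _) (hq _)
  have hid : (fun k => c (q (t k))) = id := by
    rw [← hmono.range_inj strictMono_id, Set.range_id]
    exact (Finite.surjective_of_injective hmono.injective).range_eq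
  apply hij
  simpa [t, q] using congrFun hid (c j)

end Normalizer

section MaximalCompact

variable {c : Fin N → Fin k₀}

lemma one_mem_Kgrp : (1 : Matrix.SpecialLinearGroup (Fin N) ℝ) ∈ Kgrp c :=
  ⟨isBlockDiag_one, fun k => by
    rw [Matrix.SpecialLinearGroup.coe_one, blockOf_one]; simp⟩

lemma Kgrp_subset_NKset : Kgrp c ⊆ NKset c := fun _ hg =>
  mem_NKset_of_isBlockDiag (IsBlockDiag.mul_transpose_eq_one_iff hg.1 |>.mpr fun k => (hg.2 k).1)
    hg.1

lemma isPreconnected_image_val_Kgrp : IsPreconnected (Subtype.val '' Kgrp c) := by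
  have h := (isPreconnected_univ_pi fun k : Fin k₀ =>
    isPreconnected_specialOrthogonal {i : Fin N // c i = k}).image (ofBlocks c)
      continuous_ofBlocks.continuousOn
  convert h using 1
  ext M
  constructor
  · rintro ⟨g, hg, rfl⟩
    exact ⟨blockOf c g.1, fun k _ => hg.2 k,
      (isBlockDiag_ofBlocks _).ext hg.1 (blockOf_ofBlocks _)⟩
  · rintro ⟨D, hD, rfl⟩
    have hd := isBlockDiag_ofBlocks (c := c) D
    refine ⟨⟨ofBlocks c D, ?_⟩, ⟨hd, fun k => ?_⟩, rfl⟩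
    · rw [hd.det]
      exact Finset.prod_eq_one fun k _ => by rw [blockOf_ofBlocks]; exact (hD k trivial).2
    · rw [blockOf_ofBlocks]
      exact hD k trivial

lemma isPreconnected_Kgrp_mul_Ugrp : IsPreconnected (Kgrp c * Ugrp c) := by
  have hind : Topology.IsInducing fun g : Matrix.SpecialLinearGroup (Fin N) ℝ => g.1 := ⟨rfl⟩
  have hmul : (fun g : Matrix.SpecialLinearGroup (Fin N) ℝ => g.1) '' (Kgrp c * Ugrp c) =
      (Subtype.val '' Kgrp c) * (Subtype.val '' Ugrp c) :=
    Set.image_image2_distrib fun _ _ => rfl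
  rw [← hind.isPreconnected_image, hmul]
  exact isPreconnected_image_val_Kgrp.set_mul isPreconnected_image_val_Ugrp

end MaximalCompact

/-- the identity component (connected component of `1` in the subspace
topology) of `N_{SO_N(ℝ)}(U_{𝓘₀})·U_{𝓘₀}` equals `K_{𝓘₀}·U_{𝓘₀}`. -/
theorem stmt4 (hN : 2 ≤ N) (c : Fin N → Fin k₀) (hmono : Monotone c)
    (hsurj : Function.Surjective c) :
    connectedComponentIn (NKset c * Ugrp c) 1 = Kgrp c * Ugrp c := by
  have h1 : (1 : Matrix.SpecialLinearGroup (Fin N) ℝ) ∈ Kgrp c * Ugrp c :=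
    Set.mem_mul.mpr ⟨1, one_mem_Kgrp, 1, one_mem_Ugrp, one_mul 1⟩
  have hsub : Kgrp c * Ugrp c ⊆ NKset c * Ugrp c := Set.mul_subset_mul_right Kgrp_subset_NKset
  refine Set.Subset.antisymm ?_
    (isPreconnected_Kgrp_mul_Ugrp.subset_connectedComponentIn h1 hsub)
  intro h hh
  have hmem := connectedComponentIn_subset _ _ hh
  obtain ⟨g, hg, u, hu, rfl⟩ := Set.mem_mul.mp hmem
  have hblock {g u : Matrix.SpecialLinearGroup (Fin N) ℝ} (hg : g ∈ NKset c) (hu : u ∈ Ugrp c)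
      (k : Fin k₀) : blockOf c (g * u).1 k = blockOf c g.1 k := by
    have := (isBlockDiag_of_mem_NKset hsurj hg).blockOf_mul (B := u.1) k
    rwa [blockOf_of_mem_Ugrp hu, mul_one] at this
  have horth {g : Matrix.SpecialLinearGroup (Fin N) ℝ} (hg : g ∈ NKset c) (k : Fin k₀) :
      blockOf c g.1 k * (blockOf c g.1 k)ᵀ = 1 :=
    (isBlockDiag_of_mem_NKset hsurj hg).mul_transpose_eq_one_iff.mp hg.1 k
  refine Set.mem_mul.mpr
    ⟨g, ⟨isBlockDiag_of_mem_NKset hsurj hg, fun k => ⟨horth hg k, ?_⟩⟩, u, hu, rfl⟩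
  have hcont : Continuous fun x : Matrix.SpecialLinearGroup (Fin N) ℝ => (blockOf c x.1 k).det := by
    have hval : Continuous
        (Subtype.val : Matrix.SpecialLinearGroup (Fin N) ℝ → Matrix (Fin N) (Fin N) ℝ) :=
      continuous_induced_dom
    exact (hval.matrix_submatrix Subtype.val Subtype.val).matrix_det
  have hmaps : Set.MapsTo (fun x : Matrix.SpecialLinearGroup (Fin N) ℝ => (blockOf c x.1 k).det)
      (connectedComponentIn (NKset c * Ugrp c) 1) {1, -1} := by
    intro x hx
    obtain ⟨g, hg, u, hu, rfl⟩ := Set.mem_mul.mp (connectedComponentIn_subset _ _ hx)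
    have hdet := congrArg Matrix.det (horth hg k)
    rw [Matrix.det_mul, Matrix.det_transpose, Matrix.det_one] at hdet
    simpa only [hblock hg hu, Set.mem_insert_iff, Set.mem_singleton_iff] using
      mul_self_eq_one_iff.mp hdet
  have hconst := isPreconnected_connectedComponentIn.constant_of_mapsTo
    (Set.toFinite {(1 : ℝ), -1}).isDiscrete hcont.continuousOn hmaps hh
    (mem_connectedComponentIn (hsub h1))
  simp only [hblock hg hu, Matrix.SpecialLinearGroup.coe_one] at hconst
  rw [hconst, blockOf_one, Matrix.det_one]
end

section
/- Let w ∈ ℝ^{I_1 ∪ … ∪ I_{k+1}} \ ℝ^{I_1 ∪ … ∪ I_k} for some 1 ≤ k ≤ k₀ − 1. Then the map u ↦ u·w − w is a surjection from U_{𝓘₀} onto ℝ^{I_1 ∪ … ∪ I_k}. -/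
open Matrix

variable {N k₀ : ℕ}

/-- The span of the standard basis vectors `e i` for indices `i` lying in the first `m`
blocks of the partition encoded by `c` (the block of `i` is `c i`, zero-indexed). -/
def spanUpTo (c : Fin N → Fin k₀) (m : ℕ) : Submodule ℝ (Fin N → ℝ) :=
  Submodule.span ℝ {v | ∃ i : Fin N, (c i : ℕ) < m ∧ v = Pi.single i 1}

theorem mem_spanUpTo_iff {c : Fin N → Fin k₀} {m : ℕ} {v : Fin N → ℝ} :
    v ∈ spanUpTo c m ↔ ∀ i, m ≤ (c i : ℕ) → v i = 0 := by
  constructor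
  · intro hv i hi
    induction hv using Submodule.span_induction with
    | mem x hx =>
      obtain ⟨j, hj, rfl⟩ := hx
      exact Pi.single_eq_of_ne (by rintro rfl; omega) 1
    | zero => rfl
    | add x y _ _ hx hy => simp [hx, hy]
    | smul a x _ hx => simp [hx]
  · intro h
    rw [pi_eq_sum_univ' v]
    refine Submodule.sum_mem _ fun i _ => ?_
    by_cases hi : (c i : ℕ) < m
    · refine Submodule.smul_mem _ _ (Submodule.subset_span ⟨i, hi, ?_⟩)
      ext j
      simp [Pi.single_apply, eq_comm]
    · simp [h i (not_lt.mp hi)]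

theorem mulVec_sub_mem_spanUpTo {c : Fin N → Fin k₀} {k : ℕ} {w : Fin N → ℝ}
    (hw : w ∈ spanUpTo c (k + 1)) {u : Matrix.SpecialLinearGroup (Fin N) ℝ} (hu : u ∈ Ugrp c) :
    u.1.mulVec w - w ∈ spanUpTo c k := by
  rw [mem_spanUpTo_iff] at hw ⊢
  intro i hi
  have h : u.1.mulVec w - w = (u.1 - 1).mulVec w := by rw [sub_mulVec, one_mulVec]
  rw [h]
  change ∑ j, (u.1 - 1) i j * w j = 0
  refine Finset.sum_eq_zero fun j _ => ?_
  rcases le_or_gt (c j) (c i) with hji | hij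
  · simp [hu i j hji]
  · have : (c i : ℕ) < c j := hij
    simp [hw j (by omega)]

theorem exists_mem_Ugrp_mulVec_sub_eq {c : Fin N → Fin k₀} {k : ℕ} {v w : Fin N → ℝ}
    (hv : v ∈ spanUpTo c k) (hw : w ∉ spanUpTo c k) :
    ∃ u ∈ Ugrp c, u.1.mulVec w - w = v := by
  rw [mem_spanUpTo_iff] at hv hw
  push Not at hw
  obtain ⟨j, hj, hwj⟩ := hw
  refine ⟨⟨1 + vecMulVec v (Pi.single j (w j)⁻¹), ?_⟩, ?_, ?_⟩
  · rw [vecMulVec_eq Unit, det_one_add_replicateCol_mul_replicateRow]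
    simp [hv j hj]
  · intro a b hab
    have hab' : (c b : ℕ) ≤ c a := hab
    by_cases hb : b = j
    · subst hb
      simp [vecMulVec_apply, hv a (by omega)]
    · simp [vecMulVec_apply, hb]
  · simp [add_mulVec, vecMulVec_mulVec, hwj]

/-- for `w ∈ ℝ^{I_1 ∪ ⋯ ∪ I_{k+1}} \ ℝ^{I_1 ∪ ⋯ ∪ I_k}` with
`1 ≤ k ≤ k₀ − 1`, the map `u ↦ u·w − w` is a surjection from `U_{𝓘₀}` onto
`ℝ^{I_1 ∪ ⋯ ∪ I_k}`. -/
theorem stmt14 (hN : 2 ≤ N) (hk₀ : 2 ≤ k₀) (c : Fin N → Fin k₀)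
    (hmono : Monotone c) (hsurj : Function.Surjective c)
    (k : ℕ) (hk1 : 1 ≤ k) (hk2 : k ≤ k₀ - 1)
    (w : Fin N → ℝ) (hw1 : w ∈ spanUpTo c (k + 1)) (hw2 : w ∉ spanUpTo c k) :
    (fun u : Matrix.SpecialLinearGroup (Fin N) ℝ => u.1.mulVec w - w) '' Ugrp c =
      (spanUpTo c k : Set (Fin N → ℝ)) := by
  refine Set.Subset.antisymm ?_ fun v hv => exists_mem_Ugrp_mulVec_sub_eq hv hw2
  rintro _ ⟨u, hu, rfl⟩
  exact mulVec_sub_mem_spanUpTo hw1 hu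
end
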